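/- A mapping ρ : 𝒳 × 𝒴 → ℝ satisfies conditions M, OR and LI if and only if there exists a law-invariant family of increasing sets {D̂_W : W ∈ 𝒴} of functions from S_W to [0,1] such that ρ(X, W) = inf{ x ∈ ℝ : (F_{X | VaR_α(W) ≤ W ≤ VaR_β(W)}(x))_{(α,β) ∈ S_W} ∈ D̂_W } for all X ∈ 𝒳 and W ∈ 𝒴. -/

import Mathlib

open MeasureTheory ProbabilityTheory Set Filter

noncomputable section

/-- The probability measure `P` is atomless. -/
def Atomless {Ω : Type*} [MeasurableSpace Ω] (P : Measure Ω) : Prop :=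
  ∀ A : Set Ω, MeasurableSet A → 0 < P A →
    ∃ B, B ⊆ A ∧ MeasurableSet B ∧ 0 < P B ∧ P B < P A

/-- A bounded (measurable) random variable, i.e. a member of `𝒳 = L^∞`. -/
def BddRV {Ω : Type*} [MeasurableSpace Ω] (X : Ω → ℝ) : Prop :=
  Measurable X ∧ ∃ C : ℝ, ∀ ω, |X ω| ≤ C

/-- Two random variables are comonotonic. -/
def Comonotonic {Ω : Type*} (X₁ X₂ : Ω → ℝ) : Prop :=
  ∃ (Z : Ω → ℝ) (f₁ f₂ : ℝ → ℝ), Monotone f₁ ∧ Monotone f₂ ∧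
    (∀ x, f₁ x + f₂ x = x) ∧ (∀ ω, X₁ ω = f₁ (Z ω)) ∧ (∀ ω, X₂ ω = f₂ (Z ω))

/-- `K` is a Markov-kernel version of the conditional distribution of `X` given `W`. -/
def IsCondDistrib {Ω : Type*} [MeasurableSpace Ω] {N : ℕ} (P : Measure Ω)
    (X : Ω → ℝ) (W : Ω → (Fin N → ℝ)) (K : Kernel (Fin N → ℝ) ℝ) : Prop :=
  IsMarkovKernel K ∧
    ∀ B : Set ℝ, MeasurableSet B → ∀ S : Set (Fin N → ℝ), MeasurableSet S →
      P ({ω | X ω ∈ B} ∩ W ⁻¹' S) = ∫⁻ w in S, K w B ∂(P.map W)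

/-- Membership in `D*`: Borel measurable functions `ℝ^N → [0,1]`. -/
def InDstar {N : ℕ} (f : (Fin N → ℝ) → ℝ) : Prop :=
  Measurable f ∧ ∀ w, f w ∈ Icc (0:ℝ) 1

/-- Left quantile (Value-at-Risk) of a real random variable under `P`. -/
def VaRr {Ω : Type*} [MeasurableSpace Ω] (P : Measure Ω) (Z : Ω → ℝ) (q : ℝ) : ℝ :=
  sInf {x : ℝ | q ≤ (P {ω | Z ω ≤ x}).toReal}

/-- The event `{VaR_α(W) ≤ W ≤ VaR_β(W)}` (componentwise). -/
def varBox {Ω : Type*} [MeasurableSpace Ω] {N : ℕ} (P : Measure Ω)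
    (W : Ω → (Fin N → ℝ)) (α β : Fin N → ℝ) : Set Ω :=
  {ω | ∀ i, VaRr P (fun ω' => W ω' i) (α i) ≤ W ω i ∧
            W ω i ≤ VaRr P (fun ω' => W ω' i) (β i)}

/-- `S_W`: the parameter set of pairs `(α, β)` with `α ∈ (0,1)^N`, `β ∈ (0,1]^N` and
`P(VaR_α(W) ≤ W ≤ VaR_β(W)) > 0`. -/
def SW {Ω : Type*} [MeasurableSpace Ω] {N : ℕ} (P : Measure Ω)
    (W : Ω → (Fin N → ℝ)) : Set ((Fin N → ℝ) × (Fin N → ℝ)) :=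
  {p | (∀ i, p.1 i ∈ Ioo (0:ℝ) 1) ∧ (∀ i, p.2 i ∈ Ioc (0:ℝ) 1) ∧
      0 < P (varBox P W p.1 p.2)}

/-- An increasing set of `[0,1]`-valued functions on `S`. -/
def IncreasingSetOn {ι : Type*} (S : Set ι) (D : Set (ι → ℝ)) : Prop :=
  (∀ f ∈ D, ∀ p ∈ S, f p ∈ Icc (0:ℝ) 1) ∧
  ((fun _ => (1:ℝ)) ∈ D) ∧ ((fun _ => (0:ℝ)) ∉ D) ∧
  ∀ g : ι → ℝ, (∀ p ∈ S, g p ∈ Icc (0:ℝ) 1) →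
    (∃ f ∈ D, ∀ p ∈ S, f p ≤ g p) → g ∈ D

lemma aux_exists_cells {Ω : Type*} [MeasurableSpace Ω] (P : Measure Ω) [IsProbabilityMeasure P]
    (h : Atomless P) : ∃ B : ℕ → Set Ω, (∀ n, MeasurableSet (B n)) ∧
      (P.prod P) {q | ∀ n, q.1 ∈ B n ↔ q.2 ∈ B n} = 0 := by
  classical
  let E : (ℕ → Set Ω) → Set (Ω × Ω) := fun B => {q | ∀ n, q.1 ∈ B n ↔ q.2 ∈ B n}
  have hEm : ∀ B : ℕ → Set Ω, (∀ n, MeasurableSet (B n)) → MeasurableSet (E B) := by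
    intro B hB
    have : E B = ⋂ n, ((Prod.fst ⁻¹' B n ∩ Prod.snd ⁻¹' B n) ∪
        ((Prod.fst ⁻¹' B n)ᶜ ∩ (Prod.snd ⁻¹' B n)ᶜ)) := by
      ext q
      simp only [E, mem_ofPred_eq, mem_iInter, mem_union, mem_inter_iff, mem_preimage,
        mem_compl_iff]
      exact forall_congr' fun n => by tauto
    rw [this]
    exact MeasurableSet.iInter fun n =>
      ((measurable_fst (hB n)).inter (measurable_snd (hB n))).union
        ((measurable_fst (hB n)).compl.inter (measurable_snd (hB n)).compl)
  let T : Set ENNReal := {r | ∃ B : ℕ → Set Ω, (∀ n, MeasurableSet (B n)) ∧ r = (P.prod P) (E B)}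
  have hT : T.Nonempty := ⟨_, fun _ => ∅, fun _ => MeasurableSet.empty, rfl⟩
  obtain ⟨u, -, hu, hmem⟩ := exists_seq_tendsto_sInf hT (OrderBot.bddBelow T)
  choose C hC huC using hmem
  let B : ℕ → Set Ω := fun n => C n.unpair.1 n.unpair.2
  have hB : ∀ n, MeasurableSet (B n) := fun n => hC _ _
  have hsub : ∀ k, E B ⊆ E (C k) := by
    intro k q hq n
    have := hq (Nat.pair k n)
    simpa [B] using this
  have hle : (P.prod P) (E B) ≤ sInf T :=
    ge_of_tendsto' hu fun k => by rw [huC k]; exact measure_mono (hsub k)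
  refine ⟨B, hB, ?_⟩
  change (P.prod P) (E B) = 0
  by_contra hne
  have h1 := mt (Measure.measure_prod_null (μ := P) (ν := P) (hEm B hB)).2 hne
  have h2 : ∃ ω, P (Prod.mk ω ⁻¹' E B) ≠ 0 := by
    by_contra hcon
    push Not at hcon
    exact h1 (Eventually.of_forall hcon)
  obtain ⟨ω, hω⟩ := h2
  set A := Prod.mk ω ⁻¹' E B with hA
  have hAm : MeasurableSet A := measurable_prodMk_left (hEm B hB)
  obtain ⟨D, hDA, hDm, hD0, hDlt⟩ := h A hAm (pos_iff_ne_zero.2 hω)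
  let B' : ℕ → Set Ω := fun n => Nat.casesOn n D B
  have hB' : ∀ n, MeasurableSet (B' n) := by
    intro n; cases n with
    | zero => exact hDm
    | succ n => exact hB n
  have hdiff : 0 < P (A \ D) := by
    have := le_measure_sdiff (μ := P) (s₁ := A) (s₂ := D)
    exact lt_of_lt_of_le (tsub_pos_of_lt hDlt) this
  have hE'sub : E B' ⊆ E B \ (D ×ˢ (A \ D)) := by
    intro q hq
    refine ⟨fun n => hq (n+1), fun hq2 => ?_⟩
    exact hq2.2.2 ((hq 0).1 hq2.1)
  have hDsub : D ×ˢ (A \ D) ⊆ E B := by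
    intro q hq n
    have h1 : ω ∈ B n ↔ q.1 ∈ B n := hDA hq.1 n
    have h2 : ω ∈ B n ↔ q.2 ∈ B n := hq.2.1 n
    exact h1.symm.trans h2
  have hlt : (P.prod P) (E B') < (P.prod P) (E B) := by
    refine lt_of_le_of_lt (measure_mono hE'sub) ?_
    rw [measure_sdiff hDsub (hDm.prod (hAm.diff hDm)).nullMeasurableSet (measure_ne_top _ _)]
    refine ENNReal.sub_lt_self (measure_ne_top _ _) hne ?_
    rw [Measure.prod_prod]
    exact mul_ne_zero hD0.ne' hdiff.ne'
  exact absurd (csInf_le (OrderBot.bddBelow T) ⟨B', hB', rfl⟩ : sInf T ≤ _)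
    (not_le.2 (hlt.trans_le hle))

lemma aux_uniform {Ω : Type*} [MeasurableSpace Ω] (P : Measure Ω) [IsProbabilityMeasure P]
    (h : Atomless P) : ∃ U : Ω → unitInterval, Measurable U ∧ P.map U = volume := by
  classical
  obtain ⟨B, hB, h0⟩ := aux_exists_cells P h
  let V : Ω → (ℕ → Bool) := fun ω n => decide (ω ∈ B n)
  have hV : Measurable V := by
    refine measurable_pi_iff.2 fun n => ?_
    refine measurable_to_bool ?_
    have : (fun ω => V ω n) ⁻¹' {true} = B n := by ext ω; simp [V]
    rw [this]; exact hB n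
  let e := embeddingReal (ℕ → Bool)
  have he : MeasurableEmbedding e := measurableEmbedding_embeddingReal _
  let Z : Ω → ℝ := fun ω => e (V ω)
  have hZ : Measurable Z := he.measurable.comp hV
  have hat : ∀ x, P (Z ⁻¹' {x}) = 0 := by
    intro x
    have hs : (Z ⁻¹' {x}) ×ˢ (Z ⁻¹' {x}) ⊆ {q : Ω × Ω | ∀ n, q.1 ∈ B n ↔ q.2 ∈ B n} := by
      rintro ⟨a, b⟩ ⟨ha, hb⟩ n
      have : V a = V b := he.injective (ha.trans hb.symm)
      simpa [V] using congrFun this n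
    have := measure_mono_null hs h0
    rw [Measure.prod_prod] at this
    exact mul_self_eq_zero.1 this
  let l := P.map Z
  have : IsProbabilityMeasure l := Measure.isProbabilityMeasure_map hZ.aemeasurable
  have hl : ∀ x, l {x} = 0 := fun x => by
    rw [Measure.map_apply hZ (measurableSet_singleton x)]; exact hat x
  have hcont : Continuous (cdf l) := by
    rw [continuous_iff_continuousAt]
    intro x
    have h1 := (cdf l).measure_singleton x
    rw [measure_cdf, hl x] at h1
    have h2 : cdf l x ≤ Function.leftLim (cdf l) x := by
      have := ENNReal.ofReal_eq_zero.1 h1.symm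
      linarith
    have h3 : Function.leftLim (cdf l) x = cdf l x :=
      le_antisymm ((cdf l).mono.leftLim_le le_rfl) h2
    have h4 := ((cdf l).mono.continuousWithinAt_Iio_iff_leftLim_eq (x := x)).2 h3
    exact continuousAt_iff_continuous_left'_right'.2
      ⟨h4, ((cdf l).right_continuous x).mono Ioi_subset_Ici_self⟩
  have hsurj : ∀ u : ℝ, 0 < u → u < 1 → ∃ x, cdf l x = u := by
    intro u hu0 hu1
    obtain ⟨a, ha⟩ := ((tendsto_cdf_atBot l).eventually (gt_mem_nhds hu0)).exists
    obtain ⟨b, hb⟩ := ((tendsto_cdf_atTop l).eventually (lt_mem_nhds hu1)).exists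
    exact mem_range_of_exists_le_of_exists_ge hcont ⟨a, ha.le⟩ ⟨b, hb.le⟩
  let U : Ω → unitInterval := fun ω => ⟨cdf l (Z ω), cdf_nonneg l _, cdf_le_one l _⟩
  have hU : Measurable U := Measurable.subtype_mk (hcont.measurable.comp hZ)
  have : IsProbabilityMeasure (P.map U) := Measure.isProbabilityMeasure_map hU.aemeasurable
  have hlow : ∀ u : ℝ, 0 < u → u < 1 → ENNReal.ofReal u ≤ P {ω | cdf l (Z ω) ≤ u} ∧
      P {ω | cdf l (Z ω) < u} ≤ ENNReal.ofReal u := by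
    intro u h0 h1
    obtain ⟨x, hx⟩ := hsurj u h0 h1
    have hP : P {ω | Z ω ≤ x} = ENNReal.ofReal u := by
      rw [← hx, ofReal_cdf, Measure.map_apply hZ measurableSet_Iic]; rfl
    constructor
    · rw [← hP]
      exact measure_mono fun ω hω => by
        rw [mem_ofPred_eq, ← hx]; exact (cdf l).mono hω
    · rw [← hP]
      refine measure_mono fun ω hω => ?_
      rw [mem_ofPred_eq, ← hx] at hω
      exact ((cdf l).mono.reflect_lt hω).le
  refine ⟨U, hU, Measure.ext_of_Iic _ _ fun u => ?_⟩
  rw [Measure.map_apply hU measurableSet_Iic, unitInterval.volume_Iic]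
  have hpre : U ⁻¹' Iic u = {ω | cdf l (Z ω) ≤ u} := by ext ω; rfl
  rw [hpre]
  rcases eq_or_lt_of_le u.2.2 with h1 | h1
  · have : {ω | cdf l (Z ω) ≤ (u:ℝ)} = univ := by
      ext ω; simp [h1, cdf_le_one]
    rw [this, h1]; simp
  have hup : P {ω | cdf l (Z ω) ≤ u} ≤ ENNReal.ofReal u := by
    have ht : Tendsto (fun v : ℝ => ENNReal.ofReal v) (nhdsWithin (u:ℝ) (Ioi (u:ℝ)))
        (nhds (ENNReal.ofReal u)) :=
      (ENNReal.continuous_ofReal.tendsto _).mono_left nhdsWithin_le_nhds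
    refine ge_of_tendsto ht ?_
    filter_upwards [Ioo_mem_nhdsGT h1] with v hv
    refine (measure_mono ?_).trans (hlow v (u.2.1.trans_lt hv.1) hv.2).2
    intro ω hω
    exact lt_of_le_of_lt hω hv.1
  refine le_antisymm hup ?_
  rcases eq_or_lt_of_le u.2.1 with h2 | h2
  · rw [← h2]; simp
  · exact (hlow u h2 h1).1

lemma aux_realize {Ω : Type*} [MeasurableSpace Ω] (P : Measure Ω) [IsProbabilityMeasure P]
    (h : Atomless P) {Y : Type*} [MeasurableSpace Y] [StandardBorelSpace Y]
    (ν : Measure Y) [IsProbabilityMeasure ν] : ∃ Z : Ω → Y, Measurable Z ∧ P.map Z = ν := by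
  obtain ⟨U, hU, hUm⟩ := aux_uniform P h
  have : Nonempty Y := ν.nonempty_of_neZero
  obtain ⟨f, hf, hfm⟩ := Measure.exists_measurable_map_eq ν
  exact ⟨f ∘ U, hf.comp hU, by rw [← Measure.map_map hf hU, hUm, hfm]⟩

/-- Coupling. -/
lemma aux_coupling {Ω : Type*} [MeasurableSpace Ω] (P : Measure Ω) [IsProbabilityMeasure P]
    (h : Atomless P) {Y : Type*} [MeasurableSpace Y] [StandardBorelSpace Y]
    (μ μA μB : Measure Y) [IsProbabilityMeasure μ] (hA : μA ≤ μ) (hBA : μB ≤ μA) :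
    ∃ (W : Ω → Y) (A B : Set Ω), Measurable W ∧ MeasurableSet A ∧ MeasurableSet B ∧ B ⊆ A ∧
      (∀ S, MeasurableSet S → P (W ⁻¹' S) = μ S ∧ P (A ∩ W ⁻¹' S) = μA S ∧
        P (B ∩ W ⁻¹' S) = μB S) := by
  have : IsFiniteMeasure μA := isFiniteMeasure_of_le μ hA
  have : IsFiniteMeasure μB := isFiniteMeasure_of_le μA hBA
  have hm : ∀ k : Fin 3, Measurable (fun y : Y => (k, y)) := fun k => measurable_prodMk_left
  let ν : Measure (Fin 3 × Y) := μB.map (fun y => (0, y)) + (μA - μB).map (fun y => (1, y)) +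
    (μ - μA).map (fun y => (2, y))
  have hA' : (μ - μA) + μA = μ := Measure.sub_add_cancel_of_le hA
  have hB' : (μA - μB) + μB = μA := Measure.sub_add_cancel_of_le hBA
  have hAS : ∀ S, (μ - μA) S + μA S = μ S := fun S => by
    conv_rhs => rw [← hA']
    simp
  have hBS : ∀ S, (μA - μB) S + μB S = μA S := fun S => by
    conv_rhs => rw [← hB']
    simp
  have hν : ∀ T, MeasurableSet T → ν T = μB {y | (0, y) ∈ T} + (μA - μB) {y | (1, y) ∈ T} +
      (μ - μA) {y | (2, y) ∈ T} := by
    intro T hT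
    simp only [ν, Measure.add_apply]
    rw [Measure.map_apply (hm 0) hT, Measure.map_apply (hm 1) hT, Measure.map_apply (hm 2) hT]
    rfl
  have : IsProbabilityMeasure ν := ⟨by
    rw [hν _ MeasurableSet.univ]
    simp only [mem_univ, ofPred_true]
    rw [add_comm (μB univ), hBS, add_comm, hAS, measure_univ]⟩
  obtain ⟨Z, hZ, hZν⟩ := aux_realize P h ν
  have hPZ : ∀ T, MeasurableSet T → P (Z ⁻¹' T) = ν T := fun T hT => by
    rw [← hZν, Measure.map_apply hZ hT]
  have m1 : MeasurableSet {q : Fin 3 × Y | q.1 ≠ 2} :=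
    measurable_fst (MeasurableSet.of_discrete (s := {k : Fin 3 | k ≠ 2}))
  have m2 : MeasurableSet {q : Fin 3 × Y | q.1 = 0} :=
    measurable_fst (MeasurableSet.of_discrete (s := {k : Fin 3 | k = 0}))
  refine ⟨fun ω => (Z ω).2, Z ⁻¹' {q | q.1 ≠ 2}, Z ⁻¹' {q | q.1 = 0}, measurable_snd.comp hZ,
    hZ m1, hZ m2, ?_, ?_⟩
  · intro ω hω
    simp only [mem_preimage, mem_ofPred_eq] at hω ⊢
    rw [hω]; decide
  · intro S hS
    have mS : MeasurableSet {q : Fin 3 × Y | q.2 ∈ S} := measurable_snd hS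
    refine ⟨?_, ?_, ?_⟩
    · have := hPZ _ mS
      rw [hν _ mS] at this
      simp only [mem_ofPred_eq, ofPred_mem_eq] at this
      rw [add_comm (μB S), hBS, add_comm, hAS] at this
      exact this
    · have := hPZ _ (m1.inter mS)
      rw [hν _ (m1.inter mS)] at this
      simp only [mem_inter_iff, mem_ofPred_eq] at this
      simp at this
      rw [add_comm (μB S), hBS] at this
      exact this
    · have := hPZ _ (m2.inter mS)
      rw [hν _ (m2.inter mS)] at this
      simp only [mem_inter_iff, mem_ofPred_eq] at this
      simp at this
      exact this

lemma aux_law_eq {Ω : Type*} [MeasurableSpace Ω] (P : Measure Ω) [IsProbabilityMeasure P]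
    {Y : Type*} [MeasurableSpace Y] (W W' : Ω → Y) (hW : Measurable W) (hW' : Measurable W')
    (A A' : Set Ω) (hA : MeasurableSet A) (hA' : MeasurableSet A')
    (h1 : ∀ S, MeasurableSet S → P (W ⁻¹' S) = P (W' ⁻¹' S))
    (h2 : ∀ S, MeasurableSet S → P (A ∩ W ⁻¹' S) = P (A' ∩ W' ⁻¹' S)) :
    (P.map fun ω => (A.indicator (fun _ => (1:ℝ)) ω, W ω)) =
      P.map fun ω => (A'.indicator (fun _ => (1:ℝ)) ω, W' ω) := by
  have h3 : ∀ S, MeasurableSet S → P (W ⁻¹' S \ A) = P (W' ⁻¹' S \ A') := by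
    intro S hS
    have e1 := measure_inter_add_sdiff (μ := P) (W ⁻¹' S) hA
    have e2 := measure_inter_add_sdiff (μ := P) (W' ⁻¹' S) hA'
    rw [inter_comm, h2 S hS, h1 S hS, ← e2, inter_comm] at e1
    exact (ENNReal.add_right_inj (measure_ne_top _ _)).1 e1
  have key : ∀ (W : Ω → Y) (A : Set Ω), Measurable W → MeasurableSet A →
      ∀ T : Set (ℝ × Y), MeasurableSet T →
      (P.map fun ω => (A.indicator (fun _ => (1:ℝ)) ω, W ω)) T =
        P (A ∩ W ⁻¹' {w | (1, w) ∈ T}) + P (W ⁻¹' {w | (0, w) ∈ T} \ A) := by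
    intro W A hW hA T hT
    rw [Measure.map_apply ((measurable_const.indicator hA).prodMk hW) hT,
      ← measure_inter_add_sdiff _ hA]
    congr 2
    · ext ω
      by_cases hω : ω ∈ A <;> simp [hω]
    · ext ω
      by_cases hω : ω ∈ A <;> simp [hω]
  ext T hT
  rw [key W A hW hA T hT, key W' A' hW' hA' T hT, h2, h3]
  · exact measurable_prodMk_left hT
  · exact measurable_prodMk_left hT

/-- quantile of a law on the line -/
def qlaw (ν : Measure ℝ) (t : ℝ) : ℝ := sInf {x : ℝ | t ≤ (ν (Iic x)).toReal}

lemma qlaw_le_iff (ν : Measure ℝ) [IsProbabilityMeasure ν] {t : ℝ} (ht : 0 < t)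
    (hne : ∃ x, t ≤ cdf ν x) (z : ℝ) : qlaw ν t ≤ z ↔ t ≤ cdf ν z := by
  have hset : {x : ℝ | t ≤ (ν (Iic x)).toReal} = {x | t ≤ cdf ν x} := by
    ext x; simp only [mem_ofPred_eq, cdf_eq_real]; rfl
  rw [qlaw, hset]
  have hbdd : BddBelow {x | t ≤ cdf ν x} := by
    obtain ⟨a, ha⟩ := ((tendsto_cdf_atBot ν).eventually (gt_mem_nhds ht)).exists
    refine ⟨a, fun x hx => ?_⟩
    by_contra hlt
    exact absurd ((cdf ν).mono (not_le.1 hlt).le) (not_le.2 (ha.trans_le hx))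
  constructor
  · intro h
    have hr := ((cdf ν).right_continuous z).mono Ioi_subset_Ici_self
    refine ge_of_tendsto hr.tendsto ?_
    filter_upwards [self_mem_nhdsWithin] with y hy
    obtain ⟨x, hx, hxy⟩ := exists_lt_of_csInf_lt hne (lt_of_le_of_lt h hy)
    exact le_trans hx ((cdf ν).mono hxy.le)
  · intro h
    exact csInf_le hbdd h

lemma exists_le_cdf (ν : Measure ℝ) [IsProbabilityMeasure ν] {t : ℝ} (ht : t < 1) :
    ∃ x, t ≤ cdf ν x := by
  obtain ⟨a, ha⟩ := ((tendsto_cdf_atTop ν).eventually (lt_mem_nhds ht)).exists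
  exact ⟨a, ha.le⟩

lemma aux_upper (ν : Measure ℝ) [IsProbabilityMeasure ν] (b : ℝ) (hb : ν (Iic b) ≠ 0) :
    ∃ t ∈ Ioc (0:ℝ) 1, Iic b =ᵐ[ν] Iic (qlaw ν t) := by
  have h0 : 0 < cdf ν b := by
    rw [cdf_eq_real]; exact ENNReal.toReal_pos hb (measure_ne_top _ _)
  have hq := qlaw_le_iff ν h0 ⟨b, le_rfl⟩
  refine ⟨cdf ν b, ⟨h0, cdf_le_one ν b⟩, ?_⟩
  have hle : qlaw ν (cdf ν b) ≤ b := (hq b).2 le_rfl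
  refine (ae_eq_of_subset_of_measure_ge (Iic_subset_Iic.2 hle) ?_
    measurableSet_Iic.nullMeasurableSet (measure_ne_top _ _)).symm
  rw [← ofReal_cdf, ← ofReal_cdf]
  exact ENNReal.ofReal_le_ofReal ((hq _).1 le_rfl)

lemma aux_null (ν : Measure ℝ) : ν {z | ν (Iic z) = 0} = 0 := by
  refine measure_null_of_locally_null _ fun x hx => ?_
  by_cases hmax : ∃ y, x < y ∧ ν (Iic y) = 0
  · obtain ⟨y, hxy, hy⟩ := hmax
    exact ⟨Iic y, mem_nhdsWithin_of_mem_nhds (Iic_mem_nhds hxy), hy⟩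
  · refine ⟨Iic x, ?_, hx⟩
    refine mem_of_superset self_mem_nhdsWithin fun z hz => ?_
    by_contra hlt
    exact hmax ⟨z, not_le.1 hlt, hz⟩

lemma aux_lower (ν : Measure ℝ) [IsProbabilityMeasure ν] (a : ℝ) (ha : ν (Ici a) ≠ 0) :
    ∃ t : ℕ → ℝ, (∀ n, t n ∈ Ioo (0:ℝ) 1) ∧ Monotone (fun n => Ici (qlaw ν (t n))) ∧
      Ici a =ᵐ[ν] ⋃ n, Ici (qlaw ν (t n)) := by
  set p : ℝ := ν.real (Iio a) with hp
  have hp0 : 0 ≤ p := measureReal_nonneg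
  have hp1 : p < 1 := by
    have h1 : ν.real (Ici a) = 1 - p := by
      rw [hp, ← compl_Iio, probReal_compl_eq_one_sub measurableSet_Iio]
    have h2 : 0 < ν.real (Ici a) := ENNReal.toReal_pos ha (measure_ne_top _ _)
    linarith
  let t : ℕ → ℝ := fun n => p + (1 - p) / (n + 2)
  have htp : ∀ n, p < t n := fun n => by
    have : 0 < (1 - p) / ((n:ℝ) + 2) := div_pos (by linarith) (by positivity)
    simp only [t]; linarith
  have ht : ∀ n, t n ∈ Ioo (0:ℝ) 1 := fun n => by
    refine ⟨hp0.trans_lt (htp n), ?_⟩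
    have : (1 - p) / ((n:ℝ) + 2) < 1 - p := by
      rw [div_lt_iff₀ (by positivity)]
      nlinarith [(Nat.cast_nonneg n : (0:ℝ) ≤ n)]
    simp only [t]; linarith
  have hanti : ∀ m n, m ≤ n → t n ≤ t m := fun m n hmn => by
    have : (1 - p) / ((n:ℝ) + 2) ≤ (1 - p) / ((m:ℝ) + 2) := by
      refine div_le_div_of_nonneg_left (by linarith) (by positivity) ?_
      have : (m:ℝ) ≤ n := by exact_mod_cast hmn
      linarith
    simp only [t]; linarith
  have hq : ∀ n z, qlaw ν (t n) ≤ z ↔ t n ≤ cdf ν z := fun n =>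
    qlaw_le_iff ν (ht n).1 (exists_le_cdf ν (ht n).2)
  have hlim : Tendsto t atTop (nhds p) := by
    have h1 : Tendsto (fun n : ℕ => ((n:ℝ) + 2)) atTop atTop :=
      tendsto_atTop_add_const_right _ _ tendsto_natCast_atTop_atTop
    have h2 := (h1.const_div_atTop (1 - p)).const_add p
    simpa [t] using h2
  refine ⟨t, ht, ?_, ?_⟩
  · intro m n hmn
    refine Ici_subset_Ici.2 ?_
    rw [hq]
    exact (hanti m n hmn).trans ((hq m _).1 le_rfl)
  · have hsub : ⋃ n, Ici (qlaw ν (t n)) ⊆ Ici a := by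
      refine iUnion_subset fun n => ?_
      refine Ici_subset_Ici.2 ?_
      by_contra hlt
      have h1 := (hq n _).1 le_rfl
      have h2 : cdf ν (qlaw ν (t n)) ≤ p := by
        rw [cdf_eq_real, hp]
        exact measureReal_mono (fun x hx => lt_of_le_of_lt hx (not_le.1 hlt))
      linarith [htp n]
    have hnull : ν (Ici a \ ⋃ n, Ici (qlaw ν (t n))) = 0 := by
      have hN := aux_null (ν.restrict (Ici a))
      have hN' := hN
      rw [Measure.restrict_apply' measurableSet_Ici] at hN'
      refine measure_mono_null ?_ hN'
      rintro z ⟨hza, hz⟩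
      refine ⟨?_, hza⟩
      simp only [mem_iUnion, mem_Ici, not_exists] at hz
      have hz' : cdf ν z ≤ p := ge_of_tendsto' hlim fun n => by
        have := mt (hq n z).2 (hz n)
        linarith
      simp only [mem_ofPred_eq]
      rw [Measure.restrict_apply measurableSet_Iic]
      have h3 : ν.real (Iic z) = ν.real (Iio a) + ν.real (Iic z ∩ Ici a) := by
        have e := measureReal_inter_add_sdiff (μ := ν) (s := Iic z) (measurableSet_Ici (a := a))
        have : Iic z \ Ici a = Iio a := by
          ext y; simp only [Set.mem_sdiff, mem_Iic, mem_Ici, mem_Iio, not_le]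
          exact ⟨fun h => h.2, fun h => ⟨h.le.trans hza, h⟩⟩
        rw [this] at e
        linarith
      rw [cdf_eq_real] at hz'
      have h4 : ν.real (Iic z ∩ Ici a) = 0 :=
        le_antisymm (by linarith) measureReal_nonneg
      exact (measureReal_eq_zero_iff).1 h4
    exact (ae_eq_set.2 ⟨hnull, by rw [sdiff_eq_empty.2 hsub]; simp⟩)

/-- the VaR box of a law -/
def lbox {N : ℕ} (μ : Measure (Fin N → ℝ)) (α β : Fin N → ℝ) : Set (Fin N → ℝ) :=
  ⋂ i, (fun w : Fin N → ℝ => w i) ⁻¹'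
    (Ici (qlaw (μ.map fun w => w i) (α i)) ∩ Iic (qlaw (μ.map fun w => w i) (β i)))

lemma measurableSet_lbox {N : ℕ} (μ : Measure (Fin N → ℝ)) (α β : Fin N → ℝ) :
    MeasurableSet (lbox μ α β) :=
  MeasurableSet.iInter fun i => measurable_pi_apply i (measurableSet_Ici.inter measurableSet_Iic)

lemma varBox_eq {Ω : Type*} [MeasurableSpace Ω] {N : ℕ} (P : Measure Ω)
    (W : Ω → (Fin N → ℝ)) (hW : Measurable W) (α β : Fin N → ℝ) :
    varBox P W α β = W ⁻¹' lbox (P.map W) α β := by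
  have hv : ∀ i t, VaRr P (fun ω' => W ω' i) t = qlaw ((P.map W).map fun w => w i) t := by
    intro i t
    rw [Measure.map_map (measurable_pi_apply i) hW, VaRr, qlaw]
    congr 1
    ext x
    simp only [mem_ofPred_eq]
    rw [Measure.map_apply ((measurable_pi_apply i).comp hW) measurableSet_Iic]
    rfl
  ext ω
  simp only [varBox, lbox, mem_ofPred_eq, mem_preimage, mem_iInter, mem_inter_iff, mem_Ici,
    mem_Iic, hv]

lemma aux_box {N : ℕ} (μ : Measure (Fin N → ℝ)) [IsProbabilityMeasure μ] (a b : Fin N → ℝ)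
    (h : μ (Icc a b) ≠ 0) :
    ∃ (α : ℕ → Fin N → ℝ) (β : Fin N → ℝ), (∀ n i, α n i ∈ Ioo (0:ℝ) 1) ∧
      (∀ i, β i ∈ Ioc (0:ℝ) 1) ∧ Monotone (fun n => lbox μ (α n) β) ∧
      Icc a b =ᵐ[μ] ⋃ n, lbox μ (α n) β := by
  have hm : ∀ i, Measurable (fun w : Fin N → ℝ => w i) := fun i => measurable_pi_apply i
  have hpr : ∀ i, IsProbabilityMeasure (μ.map fun w => w i) := fun i =>
    Measure.isProbabilityMeasure_map (hm i).aemeasurable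
  have hup : ∀ i, ∃ t ∈ Ioc (0:ℝ) 1, Iic (b i) =ᵐ[μ.map fun w => w i]
      Iic (qlaw (μ.map fun w => w i) t) := fun i => aux_upper _ _ (by
    rw [Measure.map_apply (hm i) measurableSet_Iic]
    exact fun h0 => h (measure_mono_null (fun w hw => hw.2 i) h0))
  have hlo : ∀ i, ∃ t : ℕ → ℝ, (∀ n, t n ∈ Ioo (0:ℝ) 1) ∧
      Monotone (fun n => Ici (qlaw (μ.map fun w => w i) (t n))) ∧
      Ici (a i) =ᵐ[μ.map fun w => w i] ⋃ n, Ici (qlaw (μ.map fun w => w i) (t n)) :=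
    fun i => aux_lower _ _ (by
      rw [Measure.map_apply (hm i) measurableSet_Ici]
      exact fun h0 => h (measure_mono_null (fun w hw => hw.1 i) h0))
  choose β hβ hβe using hup
  choose α hα hαm hαe using hlo
  have hmono : ∀ i, Monotone (fun n => (fun w : Fin N → ℝ => w i) ⁻¹'
      (Ici (qlaw (μ.map fun w => w i) (α i n)) ∩ Iic (qlaw (μ.map fun w => w i) (β i)))) :=
    fun i m n hmn => preimage_mono (inter_subset_inter_left _ (hαm i hmn))
  refine ⟨fun n i => α i n, β, fun n i => hα i n, hβ, ?_, ?_⟩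
  · intro m n hmn
    exact iInter_mono fun i => hmono i hmn
  · have e1 : (⋃ n, lbox μ (fun i => α i n) β) = ⋂ i, ⋃ n, (fun w : Fin N → ℝ => w i) ⁻¹'
      (Ici (qlaw (μ.map fun w => w i) (α i n)) ∩ Iic (qlaw (μ.map fun w => w i) (β i))) :=
      iUnion_iInter_of_monotone hmono
    have e2 : Icc a b = ⋂ i, (fun w : Fin N → ℝ => w i) ⁻¹' (Ici (a i) ∩ Iic (b i)) := by
      ext w
      simp only [mem_Icc, Pi.le_def, mem_iInter, mem_preimage, mem_inter_iff, mem_Ici, mem_Iic,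
        forall_and]
    rw [e1, e2]
    refine Filter.EventuallyEq.countable_iInter fun i => ?_
    rw [← preimage_iUnion, ← iUnion_inter]
    have := (hαe i).inter (hβe i)
    exact ((hm i).quasiMeasurePreserving μ).preimage_ae_eq this

lemma aux_le {N : ℕ} (μ μA μB : Measure (Fin N → ℝ)) [IsProbabilityMeasure μ]
    (hA : μA ≤ μ) (hB : μB ≤ μ)
    (h : ∀ α β : Fin N → ℝ, (∀ i, α i ∈ Ioo (0:ℝ) 1) → (∀ i, β i ∈ Ioc (0:ℝ) 1) →
      μB (lbox μ α β) ≤ μA (lbox μ α β)) : μB ≤ μA := by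
  have i1 : IsFiniteMeasure μA := isFiniteMeasure_of_le μ hA
  have i2 : IsFiniteMeasure μB := isFiniteMeasure_of_le μ hB
  have acA : μA ≪ μ := Measure.absolutelyContinuous_of_le hA
  have acB : μB ≪ μ := Measure.absolutelyContinuous_of_le hB
  have hbox : ∀ a b, μB (Icc a b) ≤ μA (Icc a b) := by
    intro a b
    by_cases h0 : μ (Icc a b) = 0
    · rw [acB h0]; exact bot_le
    obtain ⟨α, β, hα, hβ, hmono, he⟩ := aux_box μ a b h0
    rw [measure_congr (acB.ae_eq he), measure_congr (acA.ae_eq he), hmono.measure_iUnion,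
      hmono.measure_iUnion]
    exact iSup_mono fun n => h _ _ (hα n) hβ
  have hball : ∀ x r, 0 < r → μB (Metric.closedBall x r) ≤ μA (Metric.closedBall x r) := by
    intro x r hr
    have : Metric.closedBall x r = Icc (fun i => x i - r) (fun i => x i + r) := by
      rw [closedBall_pi _ hr.le, ← pi_univ_Icc]
      simp only [Real.closedBall_eq_Icc]
    rw [this]
    exact hbox _ _
  have hd : ∀ᵐ x ∂μ, μB.rnDeriv μ x ≤ μA.rnDeriv μ x := by
    filter_upwards [Besicovitch.ae_tendsto_rnDeriv μA μ, Besicovitch.ae_tendsto_rnDeriv μB μ]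
      with x h1 h2
    refine le_of_tendsto_of_tendsto h2 h1 ?_
    filter_upwards [self_mem_nhdsWithin] with r hr
    exact ENNReal.div_le_div_right (hball x r hr) _
  have j1 : μA.HaveLebesgueDecomposition μ := Measure.haveLebesgueDecomposition_of_sigmaFinite μA μ
  have j2 : μB.HaveLebesgueDecomposition μ := Measure.haveLebesgueDecomposition_of_sigmaFinite μB μ
  rw [← Measure.withDensity_rnDeriv_eq μB μ acB, ← Measure.withDensity_rnDeriv_eq μA μ acA]
  exact withDensity_mono hd

lemma bddRV_indicator {Ω : Type*} [MeasurableSpace Ω] {A : Set Ω} (hA : MeasurableSet A) :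
    BddRV (A.indicator (fun _ => (1:ℝ))) := by
  refine ⟨measurable_const.indicator hA, 1, fun ω => ?_⟩
  by_cases h : ω ∈ A <;> simp [h]

lemma bddRV_const {Ω : Type*} [MeasurableSpace Ω] (c : ℝ) :
    BddRV (fun _ : Ω => c) := ⟨measurable_const, |c|, fun _ => le_rfl⟩

lemma bddRV_comp {Ω : Type*} [MeasurableSpace Ω] {X : Ω → ℝ} (hX : BddRV X) {φ : ℝ → ℝ}
    (h1 : Continuous φ) (h2 : StrictMono φ) : BddRV (fun ω => φ (X ω)) := by
  obtain ⟨hm, C, hC⟩ := hX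
  refine ⟨h1.measurable.comp hm, max |φ (-C)| |φ C|, fun ω => ?_⟩
  have := abs_le.1 (hC ω)
  exact abs_le_max_abs_abs (h2.monotone this.1) (h2.monotone this.2)

lemma measurableSet_varBox {Ω : Type*} [MeasurableSpace Ω] {N : ℕ} (P : Measure Ω)
    {W : Ω → (Fin N → ℝ)} (hW : Measurable W) (α β : Fin N → ℝ) :
    MeasurableSet (varBox P W α β) := by
  rw [varBox_eq P W hW]; exact hW (measurableSet_lbox _ _ _)

lemma measure_varBox {Ω : Type*} [MeasurableSpace Ω] {N : ℕ} (P : Measure Ω)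
    {W : Ω → (Fin N → ℝ)} (hW : Measurable W) (α β : Fin N → ℝ) :
    P (varBox P W α β) = P.map W (lbox (P.map W) α β) := by
  rw [varBox_eq P W hW, Measure.map_apply hW (measurableSet_lbox _ _ _)]

lemma SW_congr {Ω : Type*} [MeasurableSpace Ω] {N : ℕ} (P : Measure Ω)
    {W W' : Ω → (Fin N → ℝ)} (hW : Measurable W) (hW' : Measurable W')
    (h : P.map W = P.map W') : SW P W = SW P W' := by
  ext p
  simp only [SW, mem_ofPred_eq, measure_varBox P hW, measure_varBox P hW', h]

lemma condF_mem {Ω : Type*} [MeasurableSpace Ω] (P : Measure Ω) [IsProbabilityMeasure P]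
    (s t : Set Ω) : ((P[|s]) t).toReal ∈ Icc (0:ℝ) 1 := by
  refine ⟨ENNReal.toReal_nonneg, ?_⟩
  have : P[|s] t ≤ 1 := prob_le_one
  exact ENNReal.toReal_le_of_le_ofReal zero_le_one (by simpa using this)

lemma condF_univ {Ω : Type*} [MeasurableSpace Ω] (P : Measure Ω) [IsProbabilityMeasure P]
    {s : Set Ω} (hs : P s ≠ 0) : ((P[|s]) univ).toReal = 1 := by
  have := cond_isProbabilityMeasure (μ := P) hs
  simp

lemma aux_compare {Ω : Type*} [MeasurableSpace Ω] (P : Measure Ω) [IsProbabilityMeasure P]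
    (hatomless : Atomless P) {N : ℕ} (ρ : (Ω → ℝ) → (Ω → (Fin N → ℝ)) → ℝ)
    (hM : ∀ X Y W, BddRV X → BddRV Y → Measurable W → (∀ᵐ ω ∂P, X ω ≤ Y ω) → ρ X W ≤ ρ Y W)
    (hLI : ∀ X X' W W', BddRV X → BddRV X' → Measurable W → Measurable W' →
        (P.map fun ω => (X ω, W ω)) = (P.map fun ω => (X' ω, W' ω)) → ρ X W = ρ X' W')
    (W W' : Ω → (Fin N → ℝ)) (hW : Measurable W) (hW' : Measurable W')
    (hWW : P.map W' = P.map W) (A B : Set Ω) (hA : MeasurableSet A) (hB : MeasurableSet B)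
    (hF : ∀ p ∈ SW P W, ((P[|varBox P W' p.1 p.2]) Aᶜ).toReal ≤
      ((P[|varBox P W p.1 p.2]) Bᶜ).toReal) :
    ρ (B.indicator fun _ => 1) W ≤ ρ (A.indicator fun _ => 1) W' := by
  set μ := P.map W with hμ
  have : IsProbabilityMeasure μ := Measure.isProbabilityMeasure_map hW.aemeasurable
  let μA := (P.restrict A).map W'
  let μB := (P.restrict B).map W
  have hμA : μA ≤ μ := by
    rw [← hWW]; exact Measure.map_mono Measure.restrict_le_self hW'
  have hμB : μB ≤ μ := Measure.map_mono Measure.restrict_le_self hW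
  have eA : ∀ S, MeasurableSet S → μA S = P (A ∩ W' ⁻¹' S) := fun S hS => by
    rw [Measure.map_apply hW' hS, Measure.restrict_apply (hW' hS), inter_comm]
  have eB : ∀ S, MeasurableSet S → μB S = P (B ∩ W ⁻¹' S) := fun S hS => by
    rw [Measure.map_apply hW hS, Measure.restrict_apply (hW hS), inter_comm]
  have hle : μB ≤ μA := by
    refine aux_le μ μA μB hμA hμB fun α β hα hβ => ?_
    by_cases h0 : μ (lbox μ α β) = 0
    · rw [Measure.absolutelyContinuous_of_le hμB h0]; exact bot_le
    have hp : (α, β) ∈ SW P W :=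
      ⟨hα, hβ, by rw [measure_varBox P hW]; exact pos_iff_ne_zero.2 h0⟩
    have h1 := hF _ hp
    rw [cond_apply (measurableSet_varBox P hW' _ _), cond_apply (measurableSet_varBox P hW _ _),
      measure_varBox P hW', measure_varBox P hW, varBox_eq P W hW, varBox_eq P W' hW', hWW,
      ENNReal.toReal_mul, ENNReal.toReal_mul, ← hμ] at h1
    have hpos : 0 < ((μ (lbox μ α β))⁻¹).toReal :=
      ENNReal.toReal_pos (ENNReal.inv_ne_zero.2 (measure_ne_top _ _)) (ENNReal.inv_ne_top.2 h0)
    have h2 : P.real (W' ⁻¹' lbox μ α β ∩ Aᶜ) ≤ P.real (W ⁻¹' lbox μ α β ∩ Bᶜ) :=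
      le_of_mul_le_mul_left h1 hpos
    have hm := measurableSet_lbox μ α β
    have e1 := measureReal_inter_add_sdiff (μ := P) (s := W' ⁻¹' lbox μ α β) hA
    have e2 := measureReal_inter_add_sdiff (μ := P) (s := W ⁻¹' lbox μ α β) hB
    have e3 : P.real (W' ⁻¹' lbox μ α β) = P.real (W ⁻¹' lbox μ α β) := by
      rw [Measure.real, Measure.real, ← Measure.map_apply hW hm, ← Measure.map_apply hW' hm, hWW]
    rw [sdiff_eq] at e1 e2
    rw [eA _ hm, eB _ hm, inter_comm, inter_comm A]
    rw [← ENNReal.toReal_le_toReal (measure_ne_top _ _) (measure_ne_top _ _)]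
    change P.real _ ≤ P.real _
    have e1' : P.real (W' ⁻¹' lbox μ α β ∩ A) + P.real (W' ⁻¹' lbox μ α β ∩ Aᶜ) = _ := e1
    have e2' : P.real (W ⁻¹' lbox μ α β ∩ B) + P.real (W ⁻¹' lbox μ α β ∩ Bᶜ) = _ := e2
    linarith
  obtain ⟨V, A', B', hV, hA', hB', hsub, hall⟩ := aux_coupling P hatomless μ μA μB hμA hle
  have l1 : ρ (B.indicator fun _ => 1) W = ρ (B'.indicator fun _ => 1) V := by
    refine hLI _ _ _ _ (bddRV_indicator hB) (bddRV_indicator hB') hW hV ?_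
    refine aux_law_eq P W V hW hV B B' hB hB' (fun S hS => ?_) (fun S hS => ?_)
    · rw [(hall S hS).1, hμ, Measure.map_apply hW hS]
    · rw [(hall S hS).2.2, eB S hS]
  have l2 : ρ (A.indicator fun _ => 1) W' = ρ (A'.indicator fun _ => 1) V := by
    refine hLI _ _ _ _ (bddRV_indicator hA) (bddRV_indicator hA') hW' hV ?_
    refine aux_law_eq P W' V hW' hV A A' hA hA' (fun S hS => ?_) (fun S hS => ?_)
    · rw [(hall S hS).1, ← hWW, Measure.map_apply hW' hS]
    · rw [(hall S hS).2.1, eA S hS]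
  rw [l1, l2]
  refine hM _ _ _ (bddRV_indicator hB') (bddRV_indicator hA') hV (Eventually.of_forall fun ω => ?_)
  exact indicator_le_indicator_of_subset hsub (fun _ => zero_le_one) ω

lemma aux_forward {Ω : Type*} [MeasurableSpace Ω] (P : Measure Ω) [IsProbabilityMeasure P]
    (hatomless : Atomless P) {N : ℕ} (ρ : (Ω → ℝ) → (Ω → (Fin N → ℝ)) → ℝ)
    (hM : ∀ X Y W, BddRV X → BddRV Y → Measurable W → (∀ᵐ ω ∂P, X ω ≤ Y ω) → ρ X W ≤ ρ Y W)
    (hOR : ∀ (φ : ℝ → ℝ), Continuous φ → StrictMono φ →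
        ∀ X W, BddRV X → Measurable W → ρ (fun ω => φ (X ω)) W = φ (ρ X W))
    (hLI : ∀ X X' W W', BddRV X → BddRV X' → Measurable W → Measurable W' →
        (P.map fun ω => (X ω, W ω)) = (P.map fun ω => (X' ω, W' ω)) → ρ X W = ρ X' W') :
    ∃ Dhat : (Ω → (Fin N → ℝ)) → Set (((Fin N → ℝ) × (Fin N → ℝ)) → ℝ),
      (∀ W : Ω → (Fin N → ℝ), Measurable W → IncreasingSetOn (SW P W) (Dhat W)) ∧
      (∀ W W' : Ω → (Fin N → ℝ), Measurable W → Measurable W' →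
        P.map W = P.map W' → Dhat W = Dhat W') ∧
      (∀ X W, BddRV X → Measurable W →
        ρ X W = sInf {x : ℝ |
          (fun p : (Fin N → ℝ) × (Fin N → ℝ) =>
            ((P[|varBox P W p.1 p.2]) {ω | X ω ≤ x}).toReal) ∈ Dhat W}) := by
  have hconst : ∀ (c : ℝ) W, Measurable W → ρ (fun _ => c) W = c := by
    intro c W hW
    have := hOR (fun t => 2 * t - c) (by fun_prop) (fun a b h => by simp only; linarith)
      (fun _ => c) W (bddRV_const c) hW
    have e : (fun _ : Ω => 2 * c - c) = fun _ => c := by funext; ring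
    simp only [e] at this
    linarith
  have hind : ∀ A W, MeasurableSet A → Measurable W →
      ρ (A.indicator fun _ => 1) W = 0 ∨ ρ (A.indicator fun _ => 1) W = 1 := by
    intro A W hA hW
    set r := ρ (A.indicator fun _ => 1) W with hr
    have h3 := hOR (fun t => t ^ 3) (by fun_prop) (Odd.strictMono_pow (by decide)) _ W
      (bddRV_indicator hA) hW
    have e : (fun ω => (A.indicator (fun _ => (1:ℝ)) ω) ^ 3) = A.indicator fun _ => 1 := by
      funext ω
      by_cases h : ω ∈ A <;> simp [h]
    rw [e] at h3
    change r = r ^ 3 at h3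
    have h0 : 0 ≤ r := by
      have := hM (fun _ => 0) _ W (bddRV_const 0) (bddRV_indicator hA) hW
        (Eventually.of_forall fun ω => indicator_nonneg (fun _ _ => zero_le_one) ω)
      rwa [hconst 0 W hW] at this
    have : r * ((r - 1) * (r + 1)) = 0 := by linear_combination -h3
    rcases mul_eq_zero.1 this with h | h
    · exact Or.inl h
    · rcases mul_eq_zero.1 h with h | h
      · right; linarith
      · exfalso; linarith
  refine ⟨fun W => {g | (∀ p ∈ SW P W, g p ∈ Icc (0:ℝ) 1) ∧ ∃ W' A, Measurable W' ∧
    MeasurableSet A ∧ P.map W' = P.map W ∧ ρ (A.indicator fun _ => 1) W' = 0 ∧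
    ∀ p ∈ SW P W, ((P[|varBox P W' p.1 p.2]) Aᶜ).toReal ≤ g p}, ?_, ?_, ?_⟩
  · intro W hW
    refine ⟨fun f hf => hf.1, ⟨fun _ _ => ⟨zero_le_one, le_rfl⟩, W, ∅, hW, MeasurableSet.empty,
      rfl, ?_, fun p _ => (condF_mem P _ _).2⟩, ?_, ?_⟩
    · rw [indicator_empty]; exact hconst 0 W hW
    · rintro ⟨-, W', A, hW', hA, hWW, hz, hF⟩
      have := aux_compare P hatomless ρ hM hLI W W' hW hW' hWW A univ hA MeasurableSet.univ
        (fun p hp => (hF p hp).trans (condF_mem P _ _).1)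
      rw [hz, indicator_univ, hconst 1 W hW] at this
      linarith
    · rintro g hg ⟨f, ⟨-, W', A, hW', hA, hWW, hz, hF⟩, hfg⟩
      exact ⟨hg, W', A, hW', hA, hWW, hz, fun p hp => (hF p hp).trans (hfg p hp)⟩
  · intro W W' hW hW' h
    simp only [SW_congr P hW hW' h, h]
  · intro X W hX hW
    have hXm := hX.1
    have hAm : ∀ x, MeasurableSet {ω | x < X ω} := fun x => measurableSet_lt measurable_const hXm
    have hc : ∀ x, {ω | X ω ≤ x} = {ω | x < X ω}ᶜ := fun x => by ext ω; simp
    have hset : {x : ℝ | (fun p : (Fin N → ℝ) × (Fin N → ℝ) =>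
            ((P[|varBox P W p.1 p.2]) {ω | X ω ≤ x}).toReal) ∈
        {g : (Fin N → ℝ) × (Fin N → ℝ) → ℝ | (∀ p ∈ SW P W, g p ∈ Icc (0:ℝ) 1) ∧
          ∃ W' A, Measurable W' ∧
          MeasurableSet A ∧ P.map W' = P.map W ∧ ρ (A.indicator fun _ => 1) W' = 0 ∧
          ∀ p ∈ SW P W, ((P[|varBox P W' p.1 p.2]) Aᶜ).toReal ≤ g p}} =
        {x | ρ ({ω | x < X ω}.indicator fun _ => 1) W = 0} := by
      ext x
      simp only [mem_ofPred_eq]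
      constructor
      · rintro ⟨-, W', A, hW', hA, hWW, hz, hF⟩
        have := aux_compare P hatomless ρ hM hLI W W' hW hW' hWW A {ω | x < X ω} hA (hAm x)
          (fun p hp => by rw [← hc]; exact hF p hp)
        rcases hind _ W (hAm x) hW with h | h
        · exact h
        · rw [h, hz] at this; linarith
      · intro h
        exact ⟨fun p _ => condF_mem P _ _, W, {ω | x < X ω}, hW, hAm x, rfl, h,
          fun p _ => by rw [hc]⟩
    have hgoal : ρ X W = sInf {x | ρ ({ω | x < X ω}.indicator fun _ => 1) W = 0} := by
      have hup : ∀ x, ρ X W < x → ρ ({ω | x < X ω}.indicator fun _ => 1) W = 0 := by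
        intro x hx
        have hcφ : Continuous (fun t => Real.exp (t - x)) := by fun_prop
        have hsφ : StrictMono (fun t => Real.exp (t - x)) := fun a b h =>
          Real.exp_lt_exp.2 (by linarith)
        have h1 := hM _ _ W (bddRV_indicator (hAm x)) (bddRV_comp hX hcφ hsφ) hW
          (Eventually.of_forall fun ω => by
            by_cases h : x < X ω
            · rw [indicator_of_mem (show ω ∈ {ω | x < X ω} from h)]
              exact Real.one_le_exp (by linarith)
            · rw [indicator_of_notMem (show ω ∉ {ω | x < X ω} from h)]
              exact (Real.exp_pos _).le)
        rw [hOR _ hcφ hsφ X W hX hW] at h1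
        have h2 : Real.exp (ρ X W - x) < 1 := Real.exp_lt_one_iff.2 (by linarith)
        rcases hind _ W (hAm x) hW with h | h
        · exact h
        · rw [h] at h1; linarith
      have hlo : ∀ x, ρ ({ω | x < X ω}.indicator fun _ => 1) W = 0 → ρ X W ≤ x := by
        intro x h0
        by_contra hlt
        have hx := not_le.1 hlt
        have hcφ : Continuous (fun t => 1 - Real.exp (x - t)) := by fun_prop
        have hsφ : StrictMono (fun t => 1 - Real.exp (x - t)) := fun a b h => by
          have : Real.exp (x - b) < Real.exp (x - a) := Real.exp_lt_exp.2 (by linarith)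
          simp only; linarith
        have h1 := hM _ _ W (bddRV_comp hX hcφ hsφ) (bddRV_indicator (hAm x)) hW
          (Eventually.of_forall fun ω => by
            by_cases h : x < X ω
            · rw [indicator_of_mem (show ω ∈ {ω | x < X ω} from h)]
              linarith [Real.exp_pos (x - X ω)]
            · rw [indicator_of_notMem (show ω ∉ {ω | x < X ω} from h)]
              linarith [Real.one_le_exp (show 0 ≤ x - X ω by linarith)])
        rw [hOR _ hcφ hsφ X W hX hW, h0] at h1
        have h2 : Real.exp (x - ρ X W) < 1 := Real.exp_lt_one_iff.2 (by linarith)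
        linarith
      refine le_antisymm (le_csInf ⟨ρ X W + 1, hup _ (by linarith)⟩ hlo) ?_
      refine le_of_forall_gt_imp_ge_of_dense fun x hx => ?_
      exact csInf_le ⟨ρ X W, hlo⟩ (hup x hx)
    rw [hgoal, ← hset]

lemma aux_backward {Ω : Type*} [MeasurableSpace Ω] (P : Measure Ω) [IsProbabilityMeasure P]
    {N : ℕ} (ρ : (Ω → ℝ) → (Ω → (Fin N → ℝ)) → ℝ)
    (Dhat : (Ω → (Fin N → ℝ)) → Set (((Fin N → ℝ) × (Fin N → ℝ)) → ℝ))
    (hD : ∀ W : Ω → (Fin N → ℝ), Measurable W → IncreasingSetOn (SW P W) (Dhat W))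
    (hDL : ∀ W W' : Ω → (Fin N → ℝ), Measurable W → Measurable W' →
        P.map W = P.map W' → Dhat W = Dhat W')
    (hρ : ∀ X W, BddRV X → Measurable W →
        ρ X W = sInf {x : ℝ |
          (fun p : (Fin N → ℝ) × (Fin N → ℝ) =>
            ((P[|varBox P W p.1 p.2]) {ω | X ω ≤ x}).toReal) ∈ Dhat W}) :
    ((∀ X Y W, BddRV X → BddRV Y → Measurable W → (∀ᵐ ω ∂P, X ω ≤ Y ω) → ρ X W ≤ ρ Y W) ∧
     (∀ (φ : ℝ → ℝ), Continuous φ → StrictMono φ →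
        ∀ X W, BddRV X → Measurable W → ρ (fun ω => φ (X ω)) W = φ (ρ X W)) ∧
     (∀ X X' W W', BddRV X → BddRV X' → Measurable W → Measurable W' →
        (P.map fun ω => (X ω, W ω)) = (P.map fun ω => (X' ω, W' ω)) → ρ X W = ρ X' W')) := by
  have hlow : ∀ (X : Ω → ℝ) W x, Measurable W → (∀ ω, x < X ω) →
      ¬ (fun p : (Fin N → ℝ) × (Fin N → ℝ) =>
            ((P[|varBox P W p.1 p.2]) {ω | X ω ≤ x}).toReal) ∈ Dhat W := by
    intro X W x hW hx hmem
    have e : {ω | X ω ≤ x} = ∅ := by ext ω; simpa using hx ω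
    simp only [e, measure_empty, ENNReal.toReal_zero] at hmem
    exact (hD W hW).2.2.1 hmem
  have hhigh : ∀ (X : Ω → ℝ) W x, Measurable W → (∀ ω, X ω ≤ x) →
      (fun p : (Fin N → ℝ) × (Fin N → ℝ) =>
            ((P[|varBox P W p.1 p.2]) {ω | X ω ≤ x}).toReal) ∈ Dhat W := by
    intro X W x hW hx
    have e : {ω | X ω ≤ x} = univ := by ext ω; simpa using hx ω
    refine (hD W hW).2.2.2 _ (fun p _ => condF_mem P _ _) ⟨_, (hD W hW).2.1, fun p hp => ?_⟩
    rw [e, condF_univ P hp.2.2.ne']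
  have hne : ∀ X W, BddRV X → Measurable W → {x : ℝ |
          (fun p : (Fin N → ℝ) × (Fin N → ℝ) =>
            ((P[|varBox P W p.1 p.2]) {ω | X ω ≤ x}).toReal) ∈ Dhat W}.Nonempty := by
    rintro X W ⟨-, C, hC⟩ hW
    exact ⟨C, hhigh X W C hW fun ω => (abs_le.1 (hC ω)).2⟩
  have hbd : ∀ X W, BddRV X → Measurable W → BddBelow {x : ℝ |
          (fun p : (Fin N → ℝ) × (Fin N → ℝ) =>
            ((P[|varBox P W p.1 p.2]) {ω | X ω ≤ x}).toReal) ∈ Dhat W} := by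
    rintro X W ⟨-, C, hC⟩ hW
    refine ⟨-C, fun x hx => ?_⟩
    by_contra hlt
    exact hlow X W x hW (fun ω => (not_le.1 hlt).trans_le (abs_le.1 (hC ω)).1) hx
  refine ⟨?_, ?_, ?_⟩
  · intro X Y W hX hY hW hXY
    rw [hρ X W hX hW, hρ Y W hY hW]
    refine csInf_le_csInf (hbd X W hX hW) (hne Y W hY hW) fun x hx => ?_
    refine (hD W hW).2.2.2 _ (fun p _ => condF_mem P _ _) ⟨_, hx, fun p _ => ?_⟩
    refine ENNReal.toReal_mono (measure_ne_top _ _) (measure_mono_ae ?_)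
    filter_upwards [cond_absolutelyContinuous.ae_le hXY] with ω hω hY
    exact hω.trans hY
  · intro φ hφc hφm X W hX hW
    rw [hρ X W hX hW, hρ _ W (bddRV_comp hX hφc hφm) hW,
      hφm.monotone.map_csInf_of_continuousAt hφc.continuousAt (hne X W hX hW) (hbd X W hX hW)]
    have hpre : ∀ t, {ω | φ (X ω) ≤ φ t} = {ω | X ω ≤ t} := fun t => by
      ext ω; exact hφm.le_iff_le
    apply le_antisymm
    · refine csInf_le_csInf (hbd _ W (bddRV_comp hX hφc hφm) hW) ((hne X W hX hW).image _) ?_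
      rintro _ ⟨t, ht, rfl⟩
      simp only [mem_ofPred_eq] at ht ⊢
      simpa only [hpre] using ht
    · refine le_csInf (hne _ W (bddRV_comp hX hφc hφm) hW) fun y hy => ?_
      have hb := hφm.monotone.map_bddBelow (hbd X W hX hW)
      obtain ⟨-, C, hC⟩ := hX
      rcases le_total (φ C) y with h1 | h1
      · exact (csInf_le hb ⟨C, hhigh X W C hW fun ω => (abs_le.1 (hC ω)).2, rfl⟩).trans h1
      · have h2 : φ (-C) ≤ y := by
          by_contra hlt
          exact hlow _ W y hW (fun ω => (not_le.1 hlt).trans_le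
            (hφm.monotone (abs_le.1 (hC ω)).1)) hy
        obtain ⟨t, rfl⟩ := mem_range_of_exists_le_of_exists_ge hφc ⟨_, h2⟩ ⟨_, h1⟩
        refine csInf_le hb ⟨t, ?_, rfl⟩
        simp only [mem_ofPred_eq] at hy ⊢
        simpa only [hpre] using hy
  · intro X X' W W' hX hX' hW hW' h
    have hWW : P.map W = P.map W' := by
      have := congrArg (Measure.map Prod.snd) h
      rwa [Measure.map_map measurable_snd (hX.1.prodMk hW),
        Measure.map_map measurable_snd (hX'.1.prodMk hW')] at this
    rw [hρ X W hX hW, hρ X' W' hX' hW', hDL W W' hW hW' hWW]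
    have hF : ∀ x (p : (Fin N → ℝ) × (Fin N → ℝ)),
        (P[|varBox P W p.1 p.2]) {ω | X ω ≤ x} = (P[|varBox P W' p.1 p.2]) {ω | X' ω ≤ x} := by
      intro x p
      rw [cond_apply (measurableSet_varBox P hW _ _), cond_apply (measurableSet_varBox P hW' _ _),
        measure_varBox P hW, measure_varBox P hW', varBox_eq P W hW, varBox_eq P W' hW', hWW]
      congr 1
      have hm : MeasurableSet (Iic x ×ˢ lbox (P.map W') p.1 p.2) :=
        measurableSet_Iic.prod (measurableSet_lbox _ _ _)
      have e := congrArg (fun m => m (Iic x ×ˢ lbox (P.map W') p.1 p.2)) h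
      rw [Measure.map_apply (hX.1.prodMk hW) hm, Measure.map_apply (hX'.1.prodMk hW') hm] at e
      rw [inter_comm, inter_comm (W' ⁻¹' _)]
      exact e
    simp only [hF]

/-- **Theorem (quantile factor risk measures, second parametrization).** `ρ` satisfies
M, OR and LI iff there exists a law-invariant family of increasing sets `{D̂_W}` of
functions on `S_W` such that
`ρ(X, W) = inf {x : (F_{X | VaR_α(W) ≤ W ≤ VaR_β(W)}(x))_{(α,β) ∈ S_W} ∈ D̂_W}`. -/
theorem stmt8 {Ω : Type*} [MeasurableSpace Ω] (P : Measure Ω) [IsProbabilityMeasure P]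
    (hatomless : Atomless P) {N : ℕ} (hN : 1 ≤ N)
    (ρ : (Ω → ℝ) → (Ω → (Fin N → ℝ)) → ℝ) :
    ((∀ X Y W, BddRV X → BddRV Y → Measurable W → (∀ᵐ ω ∂P, X ω ≤ Y ω) → ρ X W ≤ ρ Y W) ∧
     (∀ (φ : ℝ → ℝ), Continuous φ → StrictMono φ →
        ∀ X W, BddRV X → Measurable W → ρ (fun ω => φ (X ω)) W = φ (ρ X W)) ∧
     (∀ X X' W W', BddRV X → BddRV X' → Measurable W → Measurable W' →
        (P.map fun ω => (X ω, W ω)) = (P.map fun ω => (X' ω, W' ω)) → ρ X W = ρ X' W'))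
    ↔
    ∃ Dhat : (Ω → (Fin N → ℝ)) → Set (((Fin N → ℝ) × (Fin N → ℝ)) → ℝ),
      (∀ W : Ω → (Fin N → ℝ), Measurable W → IncreasingSetOn (SW P W) (Dhat W)) ∧
      (∀ W W' : Ω → (Fin N → ℝ), Measurable W → Measurable W' →
        P.map W = P.map W' → Dhat W = Dhat W') ∧
      (∀ X W, BddRV X → Measurable W →
        ρ X W = sInf {x : ℝ |
          (fun p : (Fin N → ℝ) × (Fin N → ℝ) =>
            ((P[|varBox P W p.1 p.2]) {ω | X ω ≤ x}).toReal) ∈ Dhat W}) := by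
  constructor
  · rintro ⟨hM, hOR, hLI⟩
    exact aux_forward P hatomless ρ hM hOR hLI
  · rintro ⟨Dhat, hD, hDL, hρ⟩
    exact aux_backward P ρ Dhat hD hDL hρ
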